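/- Let n be a positive integer and J a proper subset of [n−1]. Then the number of derangements of [n] with descent set J equals the number of permutations of [n] with exactly one fixed point and descent set J. -/

import Mathlib

/-- The value of a permutation of `[n] = {1, …, n}` at `i`, in 1-based terms:
for `1 ≤ i ≤ n` this is `σ(i) ∈ {1, …, n}`; outside `[n]` we return `i`. -/
def permToFun {n : ℕ} (σ : Equiv.Perm (Fin n)) (i : ℕ) : ℕ :=
  if h : 1 ≤ i ∧ i ≤ n then ((σ ⟨i - 1, by omega⟩ : Fin n) : ℕ) + 1 else i

/-- `fix σ`: the number of fixed points of a permutation of `[n]`. -/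
def fixCount {n : ℕ} (σ : Equiv.Perm (Fin n)) : ℕ :=
  ((Finset.Icc 1 n).filter fun i => permToFun σ i = i).card

/-- `exc σ`: the number of excedances of a permutation of `[n]`. -/
def excCount {n : ℕ} (σ : Equiv.Perm (Fin n)) : ℕ :=
  ((Finset.Icc 1 n).filter fun i => i < permToFun σ i).card

/-- `DES σ`: the descent set of a permutation of `[n]`, a subset of `[n-1]`. -/
def desSet {n : ℕ} (σ : Equiv.Perm (Fin n)) : Finset ℕ :=
  (Finset.Icc 1 (n - 1)).filter fun i => permToFun σ (i + 1) < permToFun σ i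

theorem countP_ofFn {α : Type*} {n : ℕ} (p : α → Prop) [DecidablePred p] (w : Fin n → α) :
    (List.ofFn w).countP (p ·) = (Finset.univ.filter fun u => p (w u)).card := by
  induction n with
  | zero => simp
  | succ n ih =>
    rw [List.ofFn_succ, List.countP_cons, ih, Finset.card_filter, Finset.card_filter,
      Fin.sum_univ_succ, add_comm]
    simp

section

variable {α : Type*} [LinearOrder α]

/-- The number of letters `x` in the word `l` that are preceded by exactly `k` letters
different from `x`. -/
def gapCount (x : α) : ℕ → List α → ℕ
  | _, [] => 0
  | k, y :: l =>
    if y = x then (if k = 0 then 1 else 0) + gapCount x k l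
    else if k = 0 then 0 else gapCount x (k - 1) l

/-- Insert the letter `a` into a word right after the first `k` letters different from `a`. -/
def gapInsert (a : α) : ℕ → List α → List α
  | 0, l => a :: l
  | _ + 1, [] => [a]
  | k + 1, y :: l => y :: gapInsert a (if y = a then k + 1 else k) l

/-- The number of letters `x` in the word `l` that keep their position when `l` is stably sorted. -/
def fixedLetters (x : α) (l : List α) : ℕ :=
  gapCount x (l.countP (· < x)) l

theorem gapCount_append (x : α) (k : ℕ) (l₁ l₂ : List α) :
    gapCount x k (l₁ ++ l₂) = gapCount x k l₁ +
      if l₁.countP (· ≠ x) ≤ k then gapCount x (k - l₁.countP (· ≠ x)) l₂ else 0 := by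
  induction l₁ generalizing k with
  | nil => simp [gapCount]
  | cons y l ih =>
    by_cases hy : y = x
    · simp [gapCount, ih, hy, add_assoc]
    · rcases k with _ | k
      · simp [gapCount, hy]
      · simp [gapCount, ih, hy, Nat.add_sub_add_right]

theorem gapCount_eq_zero_of_countP_lt (x : α) (k : ℕ) (l : List α)
    (h : l.countP (· ≠ x) < k) : gapCount x k l = 0 := by
  induction l generalizing k with
  | nil => rfl
  | cons y l ih =>
    by_cases hy : y = x
    · have : k ≠ 0 := by omega
      simp [hy] at h
      simpa [gapCount, hy, this] using ih k (by simpa using h)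
    · simp [hy] at h
      simp only [gapCount, hy, if_false]
      split_ifs
      · rfl
      · exact ih _ (by simp; omega)

theorem gapCount_eq_zero_of_not_mem {x : α} (k : ℕ) {l : List α} (h : x ∉ l) :
    gapCount x k l = 0 := by
  induction l generalizing k with
  | nil => rfl
  | cons y l ih =>
    simp only [List.mem_cons, not_or] at h
    simp [gapCount, Ne.symm h.1, ih _ h.2]

theorem fixedLetters_eq_zero_of_not_mem {x : α} {l : List α} (h : x ∉ l) :
    fixedLetters x l = 0 :=
  gapCount_eq_zero_of_not_mem _ h

theorem gapInsert_ne_nil (a : α) (k : ℕ) (l : List α) : gapInsert a k l ≠ [] := by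
  rcases k with _ | k <;> rcases l with _ | ⟨y, l⟩ <;> simp [gapInsert]

theorem gapInsert_injective (a : α) (k : ℕ) : Function.Injective (gapInsert a k) := by
  intro u v h
  induction u generalizing k v with
  | nil =>
    rcases k with _ | k <;> rcases v with _ | ⟨z, v⟩ <;> simp [gapInsert] at h ⊢
    exact gapInsert_ne_nil _ _ _ h.2
  | cons y u ih =>
    rcases k with _ | k <;> rcases v with _ | ⟨z, v⟩ <;> simp [gapInsert] at h ⊢
    · exact h
    · exact gapInsert_ne_nil _ _ _ h.2
    · obtain ⟨rfl, h⟩ := h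
      exact ⟨rfl, ih _ h⟩

theorem exists_gapInsert_eq {a : α} {k : ℕ} {l : List α} (h : gapCount a k l ≠ 0) :
    ∃ u, gapInsert a k u = l := by
  induction l generalizing k with
  | nil => exact absurd rfl h
  | cons y l ih =>
    rcases k with _ | k
    · by_cases hy : y = a
      · exact ⟨l, by simp [gapInsert, hy]⟩
      · simp [gapCount, hy] at h
    · obtain ⟨u, hu⟩ := ih (k := if y = a then k + 1 else k) (by
        split_ifs with hy <;> simpa [gapCount, hy] using h)
      exact ⟨y :: u, by simp [gapInsert, hu]⟩

theorem gapInsert_perm (a : α) (k : ℕ) (l : List α) : (gapInsert a k l).Perm (a :: l) := by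
  induction l generalizing k with
  | nil => rcases k with _ | k <;> simp [gapInsert]
  | cons y l ih =>
    rcases k with _ | k
    · simp [gapInsert]
    · exact ((ih _).cons y).trans (List.Perm.swap ..)

theorem exists_gapInsert_split {a : α} {k : ℕ} {l : List α} (h : k ≤ l.countP (· ≠ a)) :
    ∃ l₁ l₂, l = l₁ ++ l₂ ∧ gapInsert a k l = l₁ ++ a :: l₂ ∧ l₁.countP (· ≠ a) = k := by
  induction l generalizing k with
  | nil =>
    obtain rfl : k = 0 := by simpa using h
    exact ⟨[], [], by simp [gapInsert]⟩
  | cons y l ih =>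
    rcases k with _ | k
    · exact ⟨[], y :: l, by simp [gapInsert]⟩
    · obtain ⟨l₁, l₂, h₁, h₂, h₃⟩ := ih (k := if y = a then k + 1 else k) (by
        by_cases hy : y = a <;> simp [hy] at h ⊢ <;> omega)
      refine ⟨y :: l₁, l₂, by simp [h₁], by simp [gapInsert, h₂], ?_⟩
      by_cases hy : y = a <;> simp [hy] at h₃ ⊢ <;> omega

theorem countP_lt_le_countP_ne (a : α) (l : List α) :
    l.countP (· < a) ≤ l.countP (· ≠ a) :=
  List.countP_mono_left fun x _ hx => by simpa using (by simpa using hx : x < a).ne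

theorem countP_ne_add_count (x : α) (l : List α) :
    l.countP (· ≠ x) + l.count x = l.length := by
  induction l with
  | nil => rfl
  | cons y l ih =>
    by_cases hy : y = x <;> simp [hy] at ih ⊢ <;> omega

theorem countP_lt_add_count_le {x a : α} (h : x < a) (l : List α) :
    l.countP (· < x) + l.count x ≤ l.countP (· < a) := by
  induction l with
  | nil => simp
  | cons y l ih =>
    rcases lt_trichotomy y x with hy | rfl | hy
    · simp [hy, hy.ne, hy.trans h] at ih ⊢; omega
    · simp [h] at ih ⊢; omega
    · simp [hy.ne', hy.not_gt, List.countP_cons] at ih ⊢; omega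

theorem fixedLetters_gapInsert (x a : α) (l : List α) :
    fixedLetters x (gapInsert a (l.countP (· < a)) l) =
      fixedLetters x l + if x = a then 1 else 0 := by
  obtain ⟨l₁, l₂, rfl, h₂, h₃⟩ := exists_gapInsert_split (countP_lt_le_countP_ne a l)
  rw [h₂]
  unfold fixedLetters
  have e₁ := countP_ne_add_count a l₁
  have e₂ := countP_ne_add_count x l₁
  rcases lt_trichotomy x a with h | rfl | h
  · have e₃ := countP_lt_add_count_le h (l₁ ++ l₂)
    have e₄ : (l₁ ++ a :: l₂).countP (· < x) = (l₁ ++ l₂).countP (· < x) := by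
      simp [h.not_gt]
    have e₅ : l₁.countP (· ≠ a) ≤ l₁.length := List.countP_le_length
    rw [e₄, gapCount_append, gapCount_append, if_neg h.ne, add_zero]
    rw [List.count_append] at e₃
    congr 1
    split_ifs with hle
    · have hx : x ∉ l₂ := List.count_eq_zero.1 (by omega)
      rw [gapCount_eq_zero_of_not_mem _ hx, gapCount_eq_zero_of_not_mem]
      simp [h.ne, hx]
    · rfl
  · have e₄ : (l₁ ++ x :: l₂).countP (· < x) = (l₁ ++ l₂).countP (· < x) := by simp
    rw [e₄, gapCount_append, gapCount_append, ← h₃]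
    simp [gapCount]
    omega
  · have e₃ := countP_lt_add_count_le h (l₁ ++ l₂)
    have e₄ : (l₁ ++ a :: l₂).countP (· < x) = (l₁ ++ l₂).countP (· < x) + 1 := by
      simp [h, add_assoc]
    rw [e₄, gapCount_append, gapCount_append, if_neg h.ne', add_zero]
    rw [List.count_append] at e₃
    rw [gapCount_eq_zero_of_countP_lt x _ l₁ (by omega), if_pos (by omega), if_pos (by omega)]
    have : gapCount x ((l₁ ++ l₂).countP (· < x)) l₁ = 0 := by
      by_cases hx : x ∈ l₁
      · have := List.count_pos_iff.2 hx
        exact gapCount_eq_zero_of_countP_lt _ _ _ (by omega)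
      · exact gapCount_eq_zero_of_not_mem _ hx
    rw [this, gapCount, if_neg h.ne, if_neg (by omega)]
    congr 2
    omega

/-- The words with content `s`. -/
def words (s : Multiset α) : Finset (List α) := s.lists.toFinset

theorem mem_words {s : Multiset α} {l : List α} : l ∈ words s ↔ s = l := by
  simp [words]

theorem fixedLetters_le_sum {x : α} {s : Finset α} (hx : x ∈ s) (l : List α) :
    fixedLetters x l ≤ ∑ y ∈ s, fixedLetters y l :=
  Finset.single_le_sum (f := fun y => fixedLetters y l) (fun _ _ => Nat.zero_le _) hx

theorem card_words_erase_filter {s : Multiset α} {a : α} (ha : a ∈ s)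
    (P Q : List α → Prop) [DecidablePred P] [DecidablePred Q]
    (hPQ : ∀ u, P u ↔ Q (gapInsert a (u.countP (· < a)) u)) :
    ((words (s.erase a)).filter P).card =
      ((words s).filter fun l => fixedLetters a l ≠ 0 ∧ Q l).card := by
  have hk : ∀ u : List α, (u : Multiset α) = s.erase a →
      u.countP (· < a) = s.countP (· < a) := by
    intro u hu
    rw [← Multiset.cons_erase ha, ← hu]
    simp
  refine Finset.card_bij (fun u _ => gapInsert a (u.countP (· < a)) u) ?_ ?_ ?_
  · intro u hu
    simp only [Finset.mem_filter, mem_words, hPQ] at hu ⊢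
    refine ⟨?_, by simp [fixedLetters_gapInsert], hu.2⟩
    rw [← Multiset.cons_erase ha, hu.1, Multiset.cons_coe]
    exact (Multiset.coe_eq_coe.2 (gapInsert_perm _ _ _)).symm
  · intro u hu v hv h
    simp only [Finset.mem_filter, mem_words] at hu hv
    rw [hk u hu.1.symm, hk v hv.1.symm] at h
    exact gapInsert_injective _ _ h
  · intro l hl
    simp only [Finset.mem_filter, mem_words] at hl
    obtain ⟨hl, hfix, hQ⟩ := hl
    obtain ⟨u, hu⟩ := exists_gapInsert_eq hfix
    have hus : (u : Multiset α) = s.erase a := by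
      rw [hl, ← hu, Multiset.coe_eq_coe.2 (gapInsert_perm _ _ _), ← Multiset.cons_coe,
        Multiset.erase_cons_head]
    have hku : u.countP (· < a) = l.countP (· < a) := by
      rw [hk u hus, hl, Multiset.coe_countP]
    rw [← hku] at hu
    refine ⟨u, ?_, hu⟩
    simp only [Finset.mem_filter, mem_words, hPQ, hu]
    exact ⟨hus.symm, hQ⟩

/-- The number of words with content `s` in which no letter from `A` is fixed by sorting. -/
def avoidCount (A : Finset α) (s : Multiset α) : ℤ :=
  ((words s).filter fun l => ∀ x ∈ A, fixedLetters x l = 0).card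

theorem avoidCount_insert_of_mem {A : Finset α} {s : Multiset α} {a : α} (hA : a ∉ A)
    (ha : a ∈ s) : avoidCount (insert a A) s = avoidCount A s - avoidCount A (s.erase a) := by
  rw [eq_sub_iff_add_eq]
  unfold avoidCount
  rw [card_words_erase_filter ha _ (fun l => ∀ x ∈ A, fixedLetters x l = 0)]
  · norm_cast
    rw [← Finset.card_filter_add_card_filter_not
      (s := (words s).filter fun l => ∀ x ∈ A, fixedLetters x l = 0)
      (fun l => fixedLetters a l = 0), Finset.filter_filter, Finset.filter_filter]
    simp only [Finset.forall_mem_insert, and_comm]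
  · intro u
    refine forall₂_congr fun x hx => ?_
    rw [fixedLetters_gapInsert, if_neg (ne_of_mem_of_not_mem hx hA), add_zero]

theorem avoidCount_insert_of_not_mem {A : Finset α} {s : Multiset α} {a : α}
    (ha : a ∉ s) : avoidCount (insert a A) s = avoidCount A s := by
  unfold avoidCount
  congr 2
  refine Finset.filter_congr fun l hl => ?_
  rw [mem_words] at hl
  rw [Finset.forall_mem_insert, and_iff_right]
  exact fixedLetters_eq_zero_of_not_mem (by simpa [hl] using ha)

theorem card_words_eq_sum_erase {s : Multiset α} (hs : s ≠ 0) :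
    (words s).card = ∑ x ∈ s.toFinset, (words (s.erase x)).card := by
  rw [← Finset.card_sigma]
  symm
  refine Finset.card_bij (fun p _ => p.1 :: p.2) ?_ ?_ ?_
  · rintro ⟨x, l⟩ h
    simp only [Finset.mem_sigma, Multiset.mem_toFinset, mem_words] at h ⊢
    rw [← Multiset.cons_coe, ← h.2, Multiset.cons_erase h.1]
  · rintro ⟨x, l⟩ _ ⟨y, m⟩ _ h
    obtain ⟨rfl, rfl⟩ := List.cons.inj h
    rfl
  · rintro (_ | ⟨x, l⟩) h
    · exact absurd (mem_words.1 h) hs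
    · rw [mem_words] at h
      exact ⟨⟨x, l⟩, by simp [h, mem_words], rfl⟩

theorem avoidCount_eq_sum_erase (A : Finset α) (s : Multiset α)
    (hs : ¬ s.Nodup ∨ ∃ x ∈ s, x ∉ A) :
    avoidCount A s = ∑ x ∈ s.toFinset, avoidCount A (s.erase x) := by
  induction A using Finset.induction_on generalizing s with
  | empty =>
    have hs0 : s ≠ 0 := by
      rintro rfl
      simp at hs
    simp [avoidCount, card_words_eq_sum_erase hs0]
  | insert a A haA ih =>
    have ihs := ih s (hs.imp_right fun ⟨x, hx, hxA⟩ =>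
      ⟨x, hx, fun h => hxA (Finset.mem_insert_of_mem h)⟩)
    by_cases ha : a ∈ s
    · have ihe := ih (s.erase a) (by
        by_cases hd : 2 ≤ s.count a
        · right
          refine ⟨a, ?_, haA⟩
          rw [← Multiset.one_le_count_iff_mem, Multiset.count_erase_self]
          omega
        · rcases hs with hs | ⟨x, hx, hxA⟩
          · left
            contrapose! hs
            rw [← Multiset.cons_erase ha, Multiset.nodup_cons]
            refine ⟨?_, hs⟩
            rw [← Multiset.one_le_count_iff_mem, Multiset.count_erase_self]
            omega
          · right
            rw [Finset.mem_insert, not_or] at hxA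
            exact ⟨x, (Multiset.mem_erase_of_ne hxA.1).2 hx, hxA.2⟩)
      have key : ∀ x ∈ s.toFinset, avoidCount (insert a A) (s.erase x) =
          avoidCount A (s.erase x) -
            if x ∈ (s.erase a).toFinset then avoidCount A ((s.erase a).erase x) else 0 := by
        intro x hx
        rw [Multiset.mem_toFinset] at hx
        have hiff : x ∈ (s.erase a).toFinset ↔ a ∈ s.erase x := by
          rw [Multiset.mem_toFinset]
          rcases eq_or_ne x a with rfl | hne
          · rfl
          · rw [Multiset.mem_erase_of_ne hne, Multiset.mem_erase_of_ne hne.symm]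
            exact iff_of_true hx ha
        split_ifs with h
        · rw [avoidCount_insert_of_mem haA (hiff.1 h), Multiset.erase_comm]
        · rw [avoidCount_insert_of_not_mem (mt hiff.2 h), sub_zero]
      rw [Finset.sum_congr rfl key, Finset.sum_sub_distrib, ← ihs,
        avoidCount_insert_of_mem haA ha, ihe, ← Finset.sum_filter]
      congr 2
      ext x
      simp only [Finset.mem_filter, Multiset.mem_toFinset]
      exact ⟨fun h => ⟨Multiset.mem_of_mem_erase h, h⟩, fun h => h.2⟩
    · rw [avoidCount_insert_of_not_mem ha, ihs]
      refine Finset.sum_congr rfl fun x _ => ?_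
      rw [avoidCount_insert_of_not_mem fun h => ha (Multiset.mem_of_mem_erase h)]

theorem sum_fixedLetters_gapInsert {s : Finset α} {a : α} (ha : a ∈ s) (u : List α) :
    ∑ x ∈ s, fixedLetters x (gapInsert a (u.countP (· < a)) u) =
      ∑ x ∈ s, fixedLetters x u + 1 := by
  simp [fixedLetters_gapInsert, Finset.sum_add_distrib, ha]

theorem card_words_fixedLetters_eq_one (s : Multiset α) :
    (((words s).filter fun l => ∑ x ∈ s.toFinset, fixedLetters x l = 1).card : ℤ) =
      ∑ a ∈ s.toFinset, avoidCount s.toFinset (s.erase a) := by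
  have h : ∀ a ∈ s.toFinset, avoidCount s.toFinset (s.erase a) =
      (((words s).filter fun l => fixedLetters a l ≠ 0 ∧
        ∑ x ∈ s.toFinset, fixedLetters x l = 1).card : ℤ) := by
    intro a ha
    unfold avoidCount
    rw [card_words_erase_filter (Multiset.mem_toFinset.1 ha) _
      (fun l => ∑ x ∈ s.toFinset, fixedLetters x l = 1)]
    intro u
    rw [sum_fixedLetters_gapInsert ha, Nat.add_eq_right, Finset.sum_eq_zero_iff]
  rw [Finset.sum_congr rfl h]
  norm_cast
  simp_rw [and_comm (a := fixedLetters _ _ ≠ 0), ← Finset.filter_filter, Finset.card_filter _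
    (Finset.filter _ _)]
  rw [Finset.sum_comm, Finset.card_eq_sum_ones]
  refine Finset.sum_congr rfl fun l hl => ?_
  rw [Finset.mem_filter] at hl
  rw [← hl.2]
  refine Finset.sum_congr rfl fun x hx => ?_
  have := fixedLetters_le_sum hx l
  split_ifs <;> omega

theorem card_words_fixedLetters_eq_zero_eq_one {s : Multiset α} (hs : ¬ s.Nodup) :
    ((words s).filter fun l => ∑ x ∈ s.toFinset, fixedLetters x l = 0).card =
      ((words s).filter fun l => ∑ x ∈ s.toFinset, fixedLetters x l = 1).card := by
  have h := avoidCount_eq_sum_erase s.toFinset s (Or.inl hs)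
  rw [← card_words_fixedLetters_eq_one] at h
  simpa [avoidCount, Finset.sum_eq_zero_iff] using h

theorem gapCount_ofFn {n : ℕ} (x : α) (k : ℕ) (w : Fin n → α) :
    gapCount x k (List.ofFn w) =
      (Finset.univ.filter fun v => w v = x ∧
        (Finset.univ.filter fun u => u < v ∧ w u ≠ x).card = k).card := by
  induction n generalizing k with
  | zero => simp [gapCount]
  | succ n ih =>
    simp only [Finset.card_filter] at ih ⊢
    rw [List.ofFn_succ, Fin.sum_univ_succ, gapCount]
    simp only [Fin.sum_univ_succ, ih]
    by_cases h : w 0 = x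
    · simp [h, eq_comm]
    · rcases k with _ | k
      · simp [h]
      · simp [h, add_comm 1]

theorem sum_fixedLetters_ofFn {n : ℕ} {b : Fin n → α} (hb : Monotone b)
    {σ : Equiv.Perm (Fin n)} (hσ : ∀ i j, i < j → b i = b j → σ i < σ j)
    {A : Finset α} (hA : ∀ i, b i ∈ A) :
    ∑ x ∈ A, fixedLetters x (List.ofFn (b ∘ σ.symm)) =
      (Finset.univ.filter fun v => σ v = v).card := by
  have hfix : ∀ v, σ v = v ↔
      (Finset.univ.filter fun u => u < v ∧ b (σ.symm u) ≠ b (σ.symm v)).card =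
        (Finset.univ.filter fun u => b (σ.symm u) < b (σ.symm v)).card := by
    intro v
    have h₁ : (v : ℕ) =
        (Finset.univ.filter fun u => u < v ∧ b (σ.symm u) ≠ b (σ.symm v)).card +
        (Finset.univ.filter fun u => u < v ∧ b (σ.symm u) = b (σ.symm v)).card := by
      rw [← Fin.card_Iio v, ← Finset.card_filter_add_card_filter_not (s := Finset.Iio v)
        (fun u => b (σ.symm u) ≠ b (σ.symm v))]
      congr 2 <;> ext u <;> simp
    have h₂ : (σ.symm v : ℕ) =
        (Finset.univ.filter fun u => b (σ.symm u) < b (σ.symm v)).card +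
        (Finset.univ.filter fun u => u < v ∧ b (σ.symm u) = b (σ.symm v)).card := by
      rw [← Fin.card_Iio (σ.symm v), ← Finset.card_union_of_disjoint]
      · rw [← Finset.card_map σ.toEmbedding]
        congr 1
        ext u
        simp only [Finset.mem_map_equiv, Finset.mem_Iio, Finset.mem_union, Finset.mem_filter,
          Finset.mem_univ, true_and]
        constructor
        · intro h
          rcases (hb h.le).lt_or_eq with h' | h'
          · exact Or.inl h'
          · exact Or.inr ⟨by simpa using hσ _ _ h h', h'⟩
        · rintro (h | ⟨h, h'⟩)
          · exact hb.reflect_lt h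
          · by_contra! hle
            rcases hle.lt_or_eq with hlt | heq
            · exact absurd (by simpa using hσ _ _ hlt h'.symm) h.not_gt
            · exact h.ne (σ.symm.injective heq).symm
      · rw [Finset.disjoint_filter]
        exact fun u _ h h' => h.ne h'.2
    rw [eq_comm, ← Equiv.symm_apply_eq, Fin.ext_iff]
    omega
  rw [Finset.card_eq_sum_card_fiberwise (f := b ∘ σ.symm) (t := A) fun v _ => hA _]
  refine Finset.sum_congr rfl fun x _ => ?_
  rw [fixedLetters, countP_ofFn (· < x), gapCount_ofFn, Finset.filter_filter]
  congr 1
  ext v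
  simp only [Finset.mem_filter, Finset.mem_univ, true_and, Function.comp_apply, hfix]
  constructor
  · rintro ⟨rfl, h⟩
    exact ⟨h, rfl⟩
  · rintro ⟨h, rfl⟩
    exact ⟨rfl, h⟩

/-- Permutations increasing on the level sets of `b` correspond to the rearrangements of `b`. -/
theorem card_perm_eq_card_words {n : ℕ} {b : Fin n → α} (hb : Monotone b) (c : ℕ) :
    Nat.card {σ : Equiv.Perm (Fin n) // (∀ i j, i < j → b i = b j → σ i < σ j) ∧
        (Finset.univ.filter fun v => σ v = v).card = c} =
      ((words (List.ofFn b : Multiset α)).filter fun l =>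
        ∑ x ∈ (List.ofFn b : Multiset α).toFinset, fixedLetters x l = c).card := by
  classical
  rw [Nat.card_eq_fintype_card, Fintype.card_subtype]
  have hA : ∀ i, b i ∈ (List.ofFn b : Multiset α).toFinset := by simp
  refine Finset.card_bij (fun σ _ => List.ofFn (b ∘ σ.symm)) ?_ ?_ ?_
  · intro σ hσ
    simp only [Finset.mem_filter, Finset.mem_univ, true_and, mem_words] at hσ ⊢
    exact ⟨(Multiset.coe_eq_coe.2 (Equiv.Perm.ofFn_comp_perm σ.symm b)).symm,
      (sum_fixedLetters_ofFn hb hσ.1 hA).trans hσ.2⟩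
  · intro σ hσ τ hτ h
    simp only [Finset.mem_filter, Finset.mem_univ, true_and] at hσ hτ
    have hsort : ∀ ρ : Equiv.Perm (Fin n), (∀ i j, i < j → b i = b j → ρ i < ρ j) →
        ρ = Tuple.sort (b ∘ ρ.symm) := by
      intro ρ hρ
      rw [Tuple.eq_sort_iff]
      simpa [Function.comp_assoc] using And.intro hb hρ
    rw [hsort σ hσ.1, hsort τ hτ.1, List.ofFn_injective h]
  · intro l hl
    simp only [Finset.mem_filter, mem_words, Multiset.coe_eq_coe] at hl
    obtain ⟨hl, hc⟩ := hl
    obtain rfl : n = l.length := by simpa using hl.length_eq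
    have hsort : l.get ∘ Tuple.sort l.get = b := by
      refine List.ofFn_injective (List.Perm.eq_of_pairwise' (r := (· ≤ ·)) ?_ ?_ ?_)
      · exact (Tuple.monotone_sort l.get).sortedLE_ofFn.pairwise
      · exact hb.sortedLE_ofFn.pairwise
      · exact (Equiv.Perm.ofFn_comp_perm _ _).trans (by simpa using hl.symm)
    have hinc : ∀ i j, i < j → b i = b j → Tuple.sort l.get i < Tuple.sort l.get j := by
      intro i j hij h
      rw [← hsort] at h
      exact (Tuple.eq_sort_iff.1 rfl).2 i j hij h
    have hw : List.ofFn (b ∘ (Tuple.sort l.get).symm) = l := by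
      conv_lhs => rw [← hsort]
      simp [Function.comp_assoc]
    refine ⟨Tuple.sort l.get, ?_, hw⟩
    simp only [Finset.mem_filter, Finset.mem_univ, true_and]
    refine ⟨hinc, ?_⟩
    rw [← sum_fixedLetters_ofFn hb hinc hA, hw, hc]

end

theorem fixCount_eq_card_filter {n : ℕ} (σ : Equiv.Perm (Fin n)) :
    fixCount σ = (Finset.univ.filter fun v => σ v = v).card := by
  symm
  refine Finset.card_bij (fun v _ => (v : ℕ) + 1) ?_ ?_ ?_
  · intro v hv
    simp only [Finset.mem_filter, Finset.mem_univ, true_and] at hv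
    have := v.isLt
    simp [permToFun, hv]
  · intro u _ v _ h
    exact Fin.ext (Nat.succ_injective h)
  · intro i hi
    simp only [Finset.mem_filter, Finset.mem_Icc] at hi
    refine ⟨⟨i - 1, by omega⟩, ?_, by simp; omega⟩
    have h := hi.2
    rw [permToFun, dif_pos hi.1] at h
    simp only [Finset.mem_filter, Finset.mem_univ, true_and, Fin.ext_iff]
    omega

theorem mem_desSet_iff {n : ℕ} (σ : Equiv.Perm (Fin n)) (k : ℕ) :
    k ∈ desSet σ ↔ ∃ i j : Fin n, (i : ℕ) + 1 = k ∧ (j : ℕ) = k ∧ σ j < σ i := by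
  simp only [desSet, Finset.mem_filter, Finset.mem_Icc]
  constructor
  · rintro ⟨hk, h⟩
    refine ⟨⟨k - 1, by omega⟩, ⟨k, by omega⟩, by simp; omega, rfl, ?_⟩
    rw [permToFun, permToFun, dif_pos (by omega), dif_pos (by omega)] at h
    exact Nat.lt_of_succ_lt_succ h
  · rintro ⟨i, j, rfl, hj, h⟩
    have := j.isLt
    refine ⟨by omega, ?_⟩
    rw [permToFun, permToFun, dif_pos (by omega), dif_pos (by omega)]
    have hj' : j = ⟨(i : ℕ) + 1 + 1 - 1, by omega⟩ := Fin.ext (by simp [hj])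
    rw [hj'] at h
    exact Nat.succ_lt_succ h

/-- The index of the block of consecutive positions that contains `i`, when `{0, …, n - 1}` is cut
before each element of `K`. -/
def blockIndex (K : Finset ℕ) {n : ℕ} (i : Fin n) : ℕ :=
  (K.filter (· ≤ (i : ℕ))).card

theorem blockIndex_monotone (K : Finset ℕ) (n : ℕ) :
    Monotone (blockIndex K : Fin n → ℕ) := fun _ _ hij =>
  Finset.card_le_card (Finset.monotone_filter_right _ fun _ _ hk => le_trans hk hij)

theorem blockIndex_eq_iff (K : Finset ℕ) {n : ℕ} {i j : Fin n} (hij : i ≤ j) :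
    blockIndex K i = blockIndex K j ↔ ∀ k ∈ K, k ≤ (j : ℕ) → k ≤ (i : ℕ) := by
  have hsub : K.filter (· ≤ (i : ℕ)) ⊆ K.filter (· ≤ (j : ℕ)) :=
    Finset.monotone_filter_right _ fun _ _ hk => le_trans hk hij
  constructor
  · intro h k hk hkj
    have := Finset.eq_of_subset_of_card_le hsub h.ge
    have hmem : k ∈ K.filter (· ≤ (j : ℕ)) := Finset.mem_filter.2 ⟨hk, hkj⟩
    rw [← this] at hmem
    exact (Finset.mem_filter.1 hmem).2
  · intro h
    refine congrArg Finset.card (hsub.antisymm fun k hk => ?_)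
    rw [Finset.mem_filter] at hk ⊢
    exact ⟨hk.1, h k hk.1 hk.2⟩

theorem desSet_subset_iff {n : ℕ} (σ : Equiv.Perm (Fin n)) (K : Finset ℕ) :
    desSet σ ⊆ K ↔
      ∀ i j : Fin n, i < j → blockIndex K i = blockIndex K j → σ i < σ j := by
  constructor
  · rintro h i ⟨j, hj⟩ hij hb
    rw [blockIndex_eq_iff K hij.le] at hb
    simp only [Fin.lt_def] at hij hb
    induction j, hij using Nat.le_induction with
    | base =>
      by_contra! hle
      have hne : σ ⟨i + 1, hj⟩ ≠ σ i := fun h => by simpa [Fin.ext_iff] using σ.injective h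
      have := hb _ (h ((mem_desSet_iff σ _).2 ⟨i, ⟨i + 1, hj⟩, rfl, rfl, hle.lt_of_ne hne⟩)) le_rfl
      omega
    | succ j hij ih =>
      refine (ih (by omega) fun k hk hkj => hb k hk (Nat.le_succ_of_le hkj)).trans ?_
      by_contra! hle
      have hne : σ ⟨j + 1, hj⟩ ≠ σ ⟨j, by omega⟩ := fun h => by
        simpa [Fin.ext_iff] using σ.injective h
      have := hb _ (h ((mem_desSet_iff σ _).2
        ⟨⟨j, by omega⟩, ⟨j + 1, hj⟩, rfl, rfl, hle.lt_of_ne hne⟩)) le_rfl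
      simp at this
      omega
  · intro h k hk
    obtain ⟨i, j, hi, hj, hlt⟩ := (mem_desSet_iff σ k).1 hk
    by_contra hkK
    have hij : i < j := by rw [Fin.lt_def]; omega
    refine (h i j hij ((blockIndex_eq_iff K hij.le).2 fun m hm hmj => ?_)).not_gt hlt
    have : m ≠ k := ne_of_mem_of_not_mem hm hkK
    omega

theorem card_desSet_subset_fixCount {n : ℕ} {K : Finset ℕ} (hK : K ⊂ Finset.Icc 1 (n - 1)) :
    Nat.card {σ : Equiv.Perm (Fin n) // desSet σ ⊆ K ∧ fixCount σ = 0} =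
      Nat.card {σ : Equiv.Perm (Fin n) // desSet σ ⊆ K ∧ fixCount σ = 1} := by
  simp only [desSet_subset_iff, fixCount_eq_card_filter]
  rw [card_perm_eq_card_words (blockIndex_monotone K n),
    card_perm_eq_card_words (blockIndex_monotone K n)]
  refine card_words_fixedLetters_eq_zero_eq_one ?_
  obtain ⟨k, hk, hkK⟩ := Finset.exists_of_ssubset hK
  rw [Finset.mem_Icc] at hk
  rw [Multiset.coe_nodup, List.nodup_ofFn]
  intro hinj
  have hij : (⟨k - 1, by omega⟩ : Fin n) ≤ ⟨k, by omega⟩ := by simp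
  have := hinj ((blockIndex_eq_iff K hij).2 fun m hm hmk => ?_)
  · rw [Fin.mk.injEq] at this
    omega
  · have : m ≠ k := ne_of_mem_of_not_mem hm hkK
    simp only at hmk ⊢
    omega

theorem card_desSet_subset_eq_sum {n : ℕ} (K : Finset ℕ) (c : ℕ) :
    Nat.card {σ : Equiv.Perm (Fin n) // desSet σ ⊆ K ∧ fixCount σ = c} =
      ∑ I ∈ K.powerset, Nat.card {σ : Equiv.Perm (Fin n) // desSet σ = I ∧ fixCount σ = c} := by
  simp only [Nat.card_eq_fintype_card, Fintype.card_subtype]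
  rw [Finset.card_eq_sum_card_fiberwise (f := desSet) (t := K.powerset)]
  · refine Finset.sum_congr rfl fun I hI => ?_
    rw [Finset.filter_filter]
    congr 1
    ext σ
    simp only [Finset.mem_filter, Finset.mem_univ, true_and]
    exact ⟨fun h => ⟨h.2, h.1.2⟩, fun h => ⟨⟨h.1 ▸ Finset.mem_powerset.1 hI, h.2⟩, h.1⟩⟩
  · intro σ hσ
    simpa using (by simpa using hσ : desSet σ ⊆ K ∧ fixCount σ = c).1

/-- For a proper subset `J ⊂ [n-1]`, the number of derangements of
`[n]` with descent set `J` equals the number of permutations of `[n]` with exactly one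
fixed point and descent set `J`. -/
theorem card_derangement_desSet_eq_card_oneFix (n : ℕ) (hn : 0 < n) (J : Finset ℕ)
    (hJ : J ⊂ Finset.Icc 1 (n - 1)) :
    Nat.card {σ : Equiv.Perm (Fin n) // desSet σ = J ∧ fixCount σ = 0}
      = Nat.card {σ : Equiv.Perm (Fin n) // desSet σ = J ∧ fixCount σ = 1} := by
  induction J using Finset.strongInduction with
  | H J ih =>
    have h := card_desSet_subset_fixCount hJ
    rw [card_desSet_subset_eq_sum, card_desSet_subset_eq_sum,
      ← Finset.sum_erase_add _ _ (Finset.mem_powerset_self J),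
      ← Finset.sum_erase_add _ _ (Finset.mem_powerset_self J)] at h
    rw [Finset.sum_congr rfl fun I hI => ?_] at h
    · exact Nat.add_left_cancel h
    · rw [Finset.mem_erase, Finset.mem_powerset] at hI
      have hIJ : I ⊂ J := hI.2.ssubset_of_ne hI.1
      exact ih I hIJ (hIJ.trans hJ)
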